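/- arXiv:1101.4182 — 2 statements merged into one kernel-verified Lean document; each statement's English description precedes it below -/
import Mathlib

section
/- Let D ≥ 3 and let G be a connected bipartite (D+1)-colored graph with p black vertices. Then Σ_J g_J = D!/2 + ((D−1)!/2)·p − Σ_{i=0}^{D} Σ_ρ ( (D−1)!/2 − Σ_{J'} g_{J'} ), where the first sum runs over all D!/2 jackets J of G, the double sum runs over all colors i and all D-bubbles B^î_ρ of colors î of G, and the innermost sum runs over all (D−1)!/2 jackets J' of the bubble B^î_ρ. -/
/-- A cyclic permutation of a finite set: a permutation with a single cycle
covering all of the set. -/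
def IsFullCycle {α : Type*} [Fintype α] [DecidableEq α] (τ : Equiv.Perm α) : Prop :=
  τ.IsCycle ∧ τ.support = Finset.univ

noncomputable section
/-- The cycle (orbit) of `π` through `b`, as a set. -/
def cycleSet {B : Type*} (π : Equiv.Perm B) (b : B) : Set B :=
  {x | π.SameCycle b x}

/-- The cycles of `π` passing through the set `s` (for a `π`-invariant `s`, these are
the cycles of the restriction of `π` to `s`). -/
def cyclesIn {B : Type*} (π : Equiv.Perm B) (s : Set B) : Set (Set B) :=
  {t | ∃ b ∈ s, t = cycleSet π b}

/-- The number of cycles of `π` passing through `s`. -/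
def numCyclesIn {B : Type*} (π : Equiv.Perm B) (s : Set B) : ℕ :=
  Nat.card (cyclesIn π s)

/-- The number of cycles (orbits, including fixed points) of `π`. -/
def numCycles {B : Type*} (π : Equiv.Perm B) : ℕ :=
  numCyclesIn π Set.univ

/-- A bipartite `(D+1)`-colored graph on black vertices `B` and white vertices `W`
is a family `σ : Fin (D+1) → B ≃ W` of bijections (the edges of each color).
`facePerm σ i j = σ_j⁻¹ ∘ σ_i` is the permutation of `B` whose cycles are the
faces of colors `{i, j}`. -/
def facePerm {D : ℕ} {B W : Type*} (σ : Fin (D + 1) → B ≃ W) (i j : Fin (D + 1)) :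
    Equiv.Perm B :=
  (σ i).trans (σ j).symm

/-- The number of faces of the jacket associated to a cyclic permutation `τ` of the
colors: the faces of colors `{c, τ c}` for all colors `c`. -/
def jacketFaces {D : ℕ} {B W : Type*} (σ : Fin (D + 1) → B ≃ W)
    (τ : Equiv.Perm (Fin (D + 1))) : ℕ :=
  ∑ c : Fin (D + 1), numCycles (facePerm σ c (τ c))

/-- The total number of faces of the graph, over all unordered pairs of distinct colors. -/
def totalFaces {D : ℕ} {B W : Type*} (σ : Fin (D + 1) → B ≃ W) : ℕ :=
  ∑ p ∈ Finset.univ.filter (fun p : Fin (D + 1) × Fin (D + 1) => p.1 < p.2),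
    numCycles (facePerm σ p.1 p.2)

/-- The subgroup of permutations of `B` generated by all `σ_j⁻¹ ∘ σ_i`. -/
def colorGroup {D : ℕ} {B W : Type*} (σ : Fin (D + 1) → B ≃ W) : Subgroup (Equiv.Perm B) :=
  Subgroup.closure {π | ∃ i j, π = facePerm σ i j}

/-- The graph is connected iff the group generated by the `σ_j⁻¹ ∘ σ_i` acts
transitively on `B`. -/
def IsConnectedGraph {D : ℕ} {B W : Type*} (σ : Fin (D + 1) → B ≃ W) : Prop :=
  ∀ b b' : B, ∃ g ∈ colorGroup σ, g b = b'

/-- The subgroup generated by the `σ_k⁻¹ ∘ σ_j` with `j, k ≠ i`. -/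
def bubbleGroup {D : ℕ} {B W : Type*} (σ : Fin (D + 1) → B ≃ W) (i : Fin (D + 1)) :
    Subgroup (Equiv.Perm B) :=
  Subgroup.closure {π | ∃ j k, j ≠ i ∧ k ≠ i ∧ π = facePerm σ j k}

/-- The `D`-bubble of colors `î` containing the black vertex `b`: its orbit under
`bubbleGroup σ i`. -/
def bubbleOf {D : ℕ} {B W : Type*} (σ : Fin (D + 1) → B ≃ W) (i : Fin (D + 1)) (b : B) :
    Set B :=
  {x | ∃ g ∈ bubbleGroup σ i, g b = x}

/-- The set of `D`-bubbles of colors `î` of the graph. -/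
def bubbles {D : ℕ} {B W : Type*} (σ : Fin (D + 1) → B ≃ W) (i : Fin (D + 1)) :
    Set (Set B) :=
  {s | ∃ b, s = bubbleOf σ i b}

open scoped Classical in
/-- The finset of all cyclic permutations of `α`. -/
noncomputable def fullCycles (α : Type*) [Fintype α] [DecidableEq α] :
    Finset (Equiv.Perm α) :=
  Finset.univ.filter IsFullCycle

/-- The number of faces of the jacket of the `D`-bubble `ρ` (of colors `î`)
associated to the cyclic permutation `ω` of `î`: for each `c ∈ î` its faces of colors
`{c, ω c}` are the cycles of the restriction of `facePerm σ c (ω c)` to `ρ`. -/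
def bubbleJacketFaces {D : ℕ} {B W : Type*} (σ : Fin (D + 1) → B ≃ W) (i : Fin (D + 1))
    (ρ : Set B) (ω : Equiv.Perm {x : Fin (D + 1) // x ≠ i}) : ℕ :=
  ∑ c : {x : Fin (D + 1) // x ≠ i},
    numCyclesIn (facePerm σ (c : Fin (D + 1)) ((ω c : Fin (D + 1)))) ρ

lemma isFullCycle_iff_cycleType {α : Type*} [Fintype α] [DecidableEq α]
    (τ : Equiv.Perm α) :
    IsFullCycle τ ↔ τ.cycleType = {Fintype.card α} := by
  constructor
  · rintro ⟨hc, hs⟩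
    rw [hc.cycleType, hs, Finset.card_univ]
  · intro ht
    have hc : τ.IsCycle := by
      rw [← Equiv.Perm.card_cycleType_eq_one, ht, Multiset.card_singleton]
    refine ⟨hc, ?_⟩
    rw [hc.cycleType, Multiset.singleton_inj] at ht
    rwa [← Finset.card_eq_iff_eq_univ]

lemma mem_fullCycles {α : Type*} [Fintype α] [DecidableEq α] {τ : Equiv.Perm α} :
    τ ∈ fullCycles α ↔ IsFullCycle τ := by
  simp [fullCycles]

lemma card_fullCycles {α : Type*} [Fintype α] [DecidableEq α] {m : ℕ}
    (h : Fintype.card α = m + 2) : (fullCycles α).card = (m + 1).factorial := by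
  have h2 := Equiv.Perm.card_of_cycleType_singleton (α := α) (n := Fintype.card α)
    (by omega) le_rfl
  rw [Nat.choose_self, mul_one] at h2
  have h3 : fullCycles α =
      Finset.univ.filter fun τ : Equiv.Perm α => τ.cycleType = {Fintype.card α} := by
    ext τ
    simp [mem_fullCycles, isFullCycle_iff_cycleType]
  rw [h3, h2, h, Nat.add_sub_assoc (by norm_num)]

lemma IsFullCycle.apply_ne {α : Type*} [Fintype α] [DecidableEq α] {τ : Equiv.Perm α}
    (hτ : IsFullCycle τ) (c : α) : τ c ≠ c := by
  rw [← Equiv.Perm.mem_support, hτ.2]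
  exact Finset.mem_univ c

lemma IsFullCycle.conj {α : Type*} [Fintype α] [DecidableEq α] {τ : Equiv.Perm α}
    (hτ : IsFullCycle τ) (g : Equiv.Perm α) : IsFullCycle (g * τ * g⁻¹) := by
  refine ⟨hτ.1.conj, ?_⟩
  rw [Equiv.Perm.support_conj, hτ.2, Finset.map_univ_equiv]

/-- By conjugation with a transposition, the number of cyclic permutations sending `c`
to `d` does not depend on `d ≠ c`. -/
lemma card_fullCycles_apply_eq_le {α : Type*} [Fintype α] [DecidableEq α] {c d e : α}
    (hd : d ≠ c) (he : e ≠ c) :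
    ((fullCycles α).filter fun τ => τ c = d).card ≤
      ((fullCycles α).filter fun τ => τ c = e).card := by
  refine Finset.card_le_card_of_injOn
    (fun τ => Equiv.swap d e * τ * (Equiv.swap d e)⁻¹) ?_ ?_
  · intro τ hτ
    simp only [Finset.coe_filter, Set.mem_ofPred_eq, mem_fullCycles] at hτ ⊢
    refine ⟨hτ.1.conj _, ?_⟩
    simp [Equiv.swap_apply_of_ne_of_ne hd.symm he.symm, hτ.2]
  · intro τ _ τ' _ h
    simpa using h

lemma card_fullCycles_apply_eq {α : Type*} [Fintype α] [DecidableEq α] {m : ℕ}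
    (h : Fintype.card α = m + 2) {c d : α} (hd : d ≠ c) :
    ((fullCycles α).filter fun τ => τ c = d).card = m.factorial := by
  have h1 : (fullCycles α).card = ∑ e ∈ Finset.univ.erase c,
      ((fullCycles α).filter fun τ => τ c = e).card :=
    Finset.card_eq_sum_card_fiberwise fun τ hτ => by
      simpa using (mem_fullCycles.1 hτ).apply_ne c
  have h2 : ∀ e ∈ Finset.univ.erase c, ((fullCycles α).filter fun τ => τ c = e).card =
      ((fullCycles α).filter fun τ => τ c = d).card := fun e he =>
    le_antisymm (card_fullCycles_apply_eq_le (Finset.ne_of_mem_erase he) hd)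
      (card_fullCycles_apply_eq_le hd (Finset.ne_of_mem_erase he))
  rw [Finset.sum_congr rfl h2, Finset.sum_const, card_fullCycles h,
    Finset.card_erase_of_mem (Finset.mem_univ c), Finset.card_univ, h, smul_eq_mul,
    Nat.add_sub_assoc (by norm_num), Nat.factorial_succ] at h1
  exact (Nat.eq_of_mul_eq_mul_left (Nat.succ_pos m) h1).symm

lemma sum_fullCycles_sum_apply {α : Type*} [Fintype α] [DecidableEq α] {m : ℕ}
    (h : Fintype.card α = m + 2) (f : α → α → ℤ) :
    ∑ τ ∈ fullCycles α, ∑ c, f c (τ c) =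
      (m.factorial : ℤ) * ∑ c, ∑ d, if d ≠ c then f c d else 0 := by
  rw [Finset.sum_comm, Finset.mul_sum]
  refine Finset.sum_congr rfl fun c _ => ?_
  rw [Finset.mul_sum, ← Finset.sum_fiberwise (fullCycles α) (fun τ => τ c)]
  refine Finset.sum_congr rfl fun d _ => ?_
  rw [Finset.sum_congr rfl (g := fun _ => f c d)
    fun τ hτ => by rw [(Finset.mem_filter.1 hτ).2], Finset.sum_const]
  split_ifs with hd
  · rw [card_fullCycles_apply_eq h hd, nsmul_eq_mul]
  · rw [Finset.filter_false_of_mem, Finset.card_empty, zero_smul, mul_zero]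
    intro τ hτ hc
    exact (mem_fullCycles.1 hτ).apply_ne c (hc.trans (not_not.1 hd))

section Bubbles

variable {D : ℕ} {B W : Type*} (σ : Fin (D + 1) → B ≃ W) (i : Fin (D + 1))

lemma bubbleOf_eq_orbit (b : B) : bubbleOf σ i b = MulAction.orbit (bubbleGroup σ i) b := by
  ext x
  simp [bubbleOf, MulAction.mem_orbit_iff, Subgroup.smul_def]

lemma mem_bubbleOf_self (b : B) : b ∈ bubbleOf σ i b :=
  ⟨1, one_mem _, rfl⟩

lemma bubbleOf_eq_of_mem {b x : B} (hx : x ∈ bubbleOf σ i b) :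
    bubbleOf σ i x = bubbleOf σ i b := by
  rw [bubbleOf_eq_orbit] at hx
  rw [bubbleOf_eq_orbit, bubbleOf_eq_orbit]
  exact MulAction.orbit_eq_iff.2 hx

lemma eq_bubbleOf_of_mem {ρ : Set B} (hρ : ρ ∈ bubbles σ i) {x : B} (hx : x ∈ ρ) :
    ρ = bubbleOf σ i x := by
  obtain ⟨b, rfl⟩ := hρ
  exact (bubbleOf_eq_of_mem σ i hx).symm

lemma mem_of_sameCycle_of_mem_bubbles {π : Equiv.Perm B} (hπ : π ∈ bubbleGroup σ i)
    {ρ : Set B} (hρ : ρ ∈ bubbles σ i) {x y : B} (hx : x ∈ ρ) (h : π.SameCycle x y) :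
    y ∈ ρ := by
  rw [eq_bubbleOf_of_mem σ i hρ hx]
  obtain ⟨k, hk⟩ := h
  exact ⟨π ^ k, zpow_mem hπ k, hk⟩

lemma facePerm_mem_bubbleGroup {j k : Fin (D + 1)} (hj : j ≠ i) (hk : k ≠ i) :
    facePerm σ j k ∈ bubbleGroup σ i :=
  Subgroup.subset_closure ⟨j, k, hj, hk, rfl⟩

lemma sum_card_bubbles [Fintype B] :
    ∑ ρ ∈ (Set.toFinite (bubbles σ i)).toFinset, Nat.card ρ = Fintype.card B := by
  classical
  rw [← Finset.card_univ, Finset.card_eq_sum_card_fiberwise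
    (f := fun b => bubbleOf σ i b) (t := (Set.toFinite (bubbles σ i)).toFinset)
    fun b _ => by simpa using ⟨b, rfl⟩]
  refine Finset.sum_congr rfl fun ρ hρ => ?_
  rw [Set.Finite.mem_toFinset] at hρ
  rw [Nat.card_eq_fintype_card, Fintype.card_subtype]
  congr 1
  ext x
  simp only [Finset.mem_filter, Finset.mem_univ, true_and]
  exact ⟨fun hx => (eq_bubbleOf_of_mem σ i hρ hx).symm,
    fun hx => hx ▸ mem_bubbleOf_self σ i x⟩

lemma sum_numCyclesIn_bubbles [Finite B] {π : Equiv.Perm B} (hπ : π ∈ bubbleGroup σ i) :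
    ∑ ρ ∈ (Set.toFinite (bubbles σ i)).toFinset, numCyclesIn π ρ = numCycles π := by
  classical
  have hcard : ∀ s : Set B, numCyclesIn π s = (Set.toFinite (cyclesIn π s)).toFinset.card :=
    fun s => Set.ncard_eq_toFinset_card _ _
  simp only [numCycles, hcard]
  rw [← Finset.card_biUnion]
  · congr 1
    ext t
    simp only [Finset.mem_biUnion, Set.Finite.mem_toFinset]
    constructor
    · rintro ⟨ρ, -, b, -, rfl⟩
      exact ⟨b, Set.mem_univ b, rfl⟩
    · rintro ⟨b, -, rfl⟩
      exact ⟨bubbleOf σ i b, ⟨b, rfl⟩, b, mem_bubbleOf_self σ i b, rfl⟩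
  · intro ρ hρ ρ' hρ' hne
    rw [Finset.mem_coe, Set.Finite.mem_toFinset] at hρ hρ'
    refine Finset.disjoint_left.2 ?_
    intro t ht ht'
    rw [Set.Finite.mem_toFinset] at ht ht'
    obtain ⟨b, hb, rfl⟩ := ht
    obtain ⟨b', hb', h⟩ := ht'
    have hbb' : b' ∈ cycleSet π b := by
      rw [h]
      exact Equiv.Perm.SameCycle.refl π b'
    have hb'' := mem_of_sameCycle_of_mem_bubbles σ i hπ hρ hb hbb'
    exact hne ((eq_bubbleOf_of_mem σ i hρ hb'').trans (eq_bubbleOf_of_mem σ i hρ' hb').symm)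

end Bubbles

/-- Summing over all `i` the contributions of ordered pairs of distinct elements different
from `i` counts each ordered pair `card α - 2` times. -/
lemma sum_sum_subtype_ne {α : Type*} [Fintype α] [DecidableEq α] {m : ℕ}
    (h : Fintype.card α = m + 2) (f : α → α → ℤ) :
    ∑ i : α, ∑ c : {x // x ≠ i}, ∑ d : {x // x ≠ i}, (if d ≠ c then f c d else 0) =
      (m : ℤ) * ∑ c, ∑ d, if d ≠ c then f c d else 0 := by
  have h1 : ∀ (i : α) (g : α → ℤ), ∑ c : {x // x ≠ i}, g c = ∑ c, if c ≠ i then g c else 0 := by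
    intro i g
    rw [← Finset.sum_filter]
    exact (Finset.sum_subtype _ (by simp) g).symm
  have h2 : ∀ i : α,
      ∑ c : {x // x ≠ i}, ∑ d : {x // x ≠ i}, (if d ≠ c then f c d else 0) =
      ∑ c, ∑ d, if c ≠ i ∧ d ≠ i ∧ d ≠ c then f c d else 0 := by
    intro i
    simp only [ne_eq, ← Subtype.coe_inj]
    have h3 := h1 i fun c => ∑ d : {x // x ≠ i}, if ¬ (d : α) = c then f c d else 0
    refine h3.trans (Finset.sum_congr rfl fun c _ => ?_)
    rw [h1 i fun d => if ¬ d = c then f c d else 0]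
    by_cases hc : c = i
    · simp [hc]
    · simp only [ne_eq, hc, not_false_eq_true, if_true, true_and, ite_and]
  simp only [h2]
  rw [Finset.sum_comm, Finset.mul_sum]
  refine Finset.sum_congr rfl fun c _ => ?_
  rw [Finset.sum_comm, Finset.mul_sum]
  refine Finset.sum_congr rfl fun d _ => ?_
  by_cases hd : d = c
  · simp [hd]
  · simp only [ne_eq, hd, not_false_eq_true, and_true, if_true]
    rw [← Finset.sum_filter, Finset.sum_const, nsmul_eq_mul]
    have h4 : (Finset.univ.filter fun i => ¬ c = i ∧ ¬ d = i) = ({c, d} : Finset α)ᶜ := by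
      ext i
      simp [eq_comm]
    rw [h4, Finset.card_compl, Finset.card_pair (Ne.symm hd), h, Nat.add_sub_cancel]

/-- For a connected bipartite `(D+1)`-colored graph with `p` black vertices (`D ≥ 3`):
`Σ_J g_J = D!/2 + ((D-1)!/2)·p - Σ_{i,ρ} ((D-1)!/2 - Σ_{J'} g_{J'})`, where `J` runs
over the `D!/2` jackets of `G`, `(i, ρ)` over all `D`-bubbles, and `J'` over the
`(D-1)!/2` jackets of the bubble `B^î_ρ`.  Integer form, multiplied by `4` and with
each sum over jackets (classes `{τ, τ⁻¹}`) replaced by the sum over the corresponding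
cyclic permutations, using `Σ_τ (2 - χ_{J(τ)}) = 4·Σ_J g_J` and
`Σ_ω (2 - χ_{J'(ω)}) = 4·Σ_{J'} g_{J'}`. -/
theorem genus_sum_bubble_relation (D : ℕ) (hD : 3 ≤ D) (B W : Type)
    [Fintype B] [DecidableEq B] [Nonempty B] (σ : Fin (D + 1) → B ≃ W)
    (hconn : IsConnectedGraph σ) :
    ∑ τ ∈ fullCycles (Fin (D + 1)),
        ((2 : ℤ) - (2 * (Fintype.card B : ℤ) - (D + 1) * (Fintype.card B : ℤ) +
          (jacketFaces σ τ : ℤ))) =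
      2 * (D.factorial : ℤ) + 2 * ((D - 1).factorial : ℤ) * (Fintype.card B : ℤ) -
        ∑ i : Fin (D + 1), ∑ ρ ∈ (Set.toFinite (bubbles σ i)).toFinset,
          (2 * ((D - 1).factorial : ℤ) -
            ∑ ω ∈ fullCycles {x : Fin (D + 1) // x ≠ i},
              ((2 : ℤ) - (2 * (Nat.card ρ : ℤ) - (D : ℤ) * (Nat.card ρ : ℤ) +
                (bubbleJacketFaces σ i ρ ω : ℤ)))) := by
  obtain ⟨k, rfl⟩ := Nat.exists_eq_add_of_le' hD
  have hcard : Fintype.card (Fin (k + 3 + 1)) = (k + 2) + 2 := by simp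
  have hcard' : ∀ i : Fin (k + 3 + 1),
      Fintype.card {x : Fin (k + 3 + 1) // x ≠ i} = (k + 1) + 2 := by
    intro i
    simp [Fintype.card_subtype_compl]
  have hjackets := sum_fullCycles_sum_apply hcard
    fun c d => (numCycles (facePerm σ c d) : ℤ)
  have hbubble : ∀ i : Fin (k + 3 + 1),
      ∑ ρ ∈ (Set.toFinite (bubbles σ i)).toFinset,
        ∑ ω ∈ fullCycles {x : Fin (k + 3 + 1) // x ≠ i}, (bubbleJacketFaces σ i ρ ω : ℤ) =
      ((k + 1).factorial : ℤ) * ∑ c : {x // x ≠ i}, ∑ d : {x // x ≠ i},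
        if d ≠ c then (numCycles (facePerm σ c d) : ℤ) else 0 := by
    intro i
    rw [← sum_fullCycles_sum_apply (hcard' i) fun c d => (numCycles (facePerm σ c d) : ℤ),
      Finset.sum_comm]
    refine Finset.sum_congr rfl fun ω _ => ?_
    simp only [bubbleJacketFaces, Nat.cast_sum]
    rw [Finset.sum_comm]
    refine Finset.sum_congr rfl fun c _ => ?_
    rw [← sum_numCyclesIn_bubbles σ i (facePerm_mem_bubbleGroup σ i c.2 (ω c).2), Nat.cast_sum]
  have hsize : ∀ i : Fin (k + 3 + 1),
      ∑ ρ ∈ (Set.toFinite (bubbles σ i)).toFinset, (Nat.card ρ : ℤ) = Fintype.card B := by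
    intro i
    rw [← sum_card_bubbles σ i, Nat.cast_sum]
  have hinner : ∀ i : Fin (k + 3 + 1), ∑ ρ ∈ (Set.toFinite (bubbles σ i)).toFinset,
      (2 * ((k + 3 - 1).factorial : ℤ) -
        ∑ ω ∈ fullCycles {x : Fin (k + 3 + 1) // x ≠ i},
          ((2 : ℤ) - (2 * (Nat.card ρ : ℤ) - ((k + 3 : ℕ) : ℤ) * (Nat.card ρ : ℤ) +
            (bubbleJacketFaces σ i ρ ω : ℤ)))) =
      -((k + 2).factorial : ℤ) * (k + 1) * Fintype.card B +
      ((k + 1).factorial : ℤ) * ∑ c : {x // x ≠ i}, ∑ d : {x // x ≠ i},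
        if d ≠ c then (numCycles (facePerm σ c d) : ℤ) else 0 := by
    intro i
    rw [← hbubble i, ← hsize i, Finset.mul_sum, ← Finset.sum_add_distrib]
    refine Finset.sum_congr rfl fun ρ _ => ?_
    simp only [Finset.sum_sub_distrib, Finset.sum_add_distrib, Finset.sum_const,
      card_fullCycles (hcard' i), nsmul_eq_mul]
    rw [show k + 3 - 1 = k + 2 from rfl, show k + 1 + 1 = k + 2 from rfl]
    push_cast
    ring
  rw [Finset.sum_congr rfl fun i _ => hinner i, Finset.sum_add_distrib, ← Finset.mul_sum, ← Finset.mul_sum,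
    sum_sum_subtype_ne hcard fun c d => (numCycles (facePerm σ c d) : ℤ)]
  simp only [jacketFaces, Nat.cast_sum, Finset.sum_sub_distrib, Finset.sum_add_distrib,
    Finset.sum_const, card_fullCycles hcard, nsmul_eq_mul, hjackets, Finset.card_univ,
    Fintype.card_fin]
  rw [show k + 3 - 1 = k + 2 from rfl, show (k + 2 + 1).factorial = (k + 3).factorial from rfl,
    Nat.factorial_succ (k + 2), Nat.factorial_succ (k + 1)]
  push_cast
  ring
end
end

section
/- Let D ≥ 3 and let G be a connected bipartite (D+1)-colored graph. If a jacket J = {τ, τ⁻¹} of G is planar (g_J = 0), then for every color i and every D-bubble B^î_ρ of colors î of G, the jacket of B^î_ρ given by the cyclic permutation of î induced by τ (obtained by deleting i from the cycle of τ, i.e., the permutation ω of î with ω(c) = τ(c) for τ(c) ≠ i and ω(τ⁻¹(i)) = τ(i)) is planar, i.e., has genus 0. -/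
noncomputable section
/-- `InducedEq i τ ω` says that the cyclic permutation of `î` induced by `τ`
(deleting `i` from the cycle of `τ`) equals `ω`. -/
def InducedEq {D : ℕ} (i : Fin (D + 1)) (τ : Equiv.Perm (Fin (D + 1)))
    (ω : Equiv.Perm {x : Fin (D + 1) // x ≠ i}) : Prop :=
  ∀ c : {x : Fin (D + 1) // x ≠ i},
    (ω c : Fin (D + 1)) =
      if τ (c : Fin (D + 1)) = i then τ (τ (c : Fin (D + 1))) else τ (c : Fin (D + 1))

open Module

/-- The rational functions on `s` taking equal values at points related by `r`. -/
def relInvariants {B : Type*} (r : B → B → Prop) (s : Set B) : Submodule ℚ (s → ℚ) where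
  carrier := {f | ∀ x y : s, r x y → f x = f y}
  zero_mem' := fun _ _ _ => rfl
  add_mem' := fun hf hg x y h => by simp [hf x y h, hg x y h]
  smul_mem' := fun a f hf x y h => by simp [hf x y h]

theorem mem_relInvariants {B : Type*} {r : B → B → Prop} {s : Set B} {f : s → ℚ} :
    f ∈ relInvariants r s ↔ ∀ x y : s, r x y → f x = f y := Iff.rfl

theorem eq_of_sameCycle_of_mem_relInvariants {B : Type*} [Finite B] {π : Equiv.Perm B}
    {s : Set B} (hs : ∀ x ∈ s, π x ∈ s) {f : s → ℚ}
    (hf : f ∈ relInvariants (fun x y => π x = y) s) {x y : s} (h : π.SameCycle x y) :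
    f x = f y := by
  obtain ⟨n, hn⟩ := h.exists_nat_pow_eq
  have key : ∀ n : ℕ, ∃ hm : (π ^ n) x ∈ s, f x = f ⟨(π ^ n) x, hm⟩ := by
    intro n
    induction n with
    | zero => exact ⟨x.2, rfl⟩
    | succ n ih =>
      obtain ⟨hm, hfx⟩ := ih
      have e : (π ^ (n + 1)) x = π ((π ^ n) x) := by rw [pow_succ', Equiv.Perm.mul_apply]
      refine ⟨e ▸ hs _ hm, hfx.trans (hf _ _ ?_)⟩
      exact e.symm
  obtain ⟨hm, hfx⟩ := key n
  rw [hfx]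
  congr 1
  exact Subtype.ext hn

theorem numCyclesIn_eq_finrank {B : Type*} [Finite B] (π : Equiv.Perm B) (s : Set B)
    (hs : ∀ x ∈ s, π x ∈ s) :
    numCyclesIn π s = finrank ℚ (relInvariants (fun x y => π x = y) s) := by
  classical
  have := Fintype.ofFinite (cyclesIn π s)
  let cyc : s → cyclesIn π s := fun x => ⟨cycleSet π x, x, x.2, rfl⟩
  have hcyc : Function.Surjective cyc := by
    rintro ⟨t, x, hx, rfl⟩
    exact ⟨⟨x, hx⟩, rfl⟩
  have hsame : ∀ x y : s, cyc x = cyc y → π.SameCycle x y := by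
    intro x y h
    have h' : cycleSet π (x : B) = cycleSet π (y : B) := congrArg Subtype.val h
    have : (y : B) ∈ cycleSet π (x : B) := h' ▸ (Equiv.Perm.SameCycle.refl π (y : B))
    exact this
  have hrange : LinearMap.range (LinearMap.funLeft ℚ ℚ cyc)
      = relInvariants (fun x y => π x = y) s := by
    ext f
    constructor
    · rintro ⟨h, rfl⟩ x y hxy
      have hxy' : π.SameCycle x y := ⟨1, by simpa using hxy⟩
      have : cyc x = cyc y := Subtype.ext <| Set.ext fun z =>
        ⟨fun hz => hxy'.symm.trans hz, fun hz => hxy'.trans hz⟩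
      simp [LinearMap.funLeft_apply, this]
    · intro hf
      refine ⟨fun t => f (Function.surjInv hcyc t), funext fun x => ?_⟩
      exact eq_of_sameCycle_of_mem_relInvariants hs hf
        (hsame _ _ (Function.surjInv_eq hcyc (cyc x)))
  rw [← hrange, LinearMap.finrank_range_of_inj (LinearMap.funLeft_injective_of_surjective ℚ ℚ _ hcyc),
    finrank_fintype_fun_eq_card, numCyclesIn, Nat.card_eq_fintype_card]

/-- Dimension count for the complex `V → ∏ range (A c) → V` given by endomorphisms with zero sum. -/
theorem finrank_add_finrank_iSup_range_le {ι V : Type*} [Fintype ι] [AddCommGroup V] [Module ℚ V]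
    [FiniteDimensional ℚ V] (A : ι → V →ₗ[ℚ] V) (hA : ∑ c, A c = 0) :
    finrank ℚ V + finrank ℚ (⨆ c, LinearMap.range (A c) : Submodule ℚ V)
      ≤ ∑ c, finrank ℚ (LinearMap.range (A c))
        + finrank ℚ (⨅ c, LinearMap.ker (A c) : Submodule ℚ V) := by
  classical
  let β : V →ₗ[ℚ] (∀ c, LinearMap.range (A c)) := LinearMap.pi fun c => (A c).rangeRestrict
  let δ : (∀ c, LinearMap.range (A c)) →ₗ[ℚ] V :=
    ∑ c, (LinearMap.range (A c)).subtype ∘ₗ LinearMap.proj c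
  have hδβ : LinearMap.range β ≤ LinearMap.ker δ := by
    rintro _ ⟨v, rfl⟩
    have := congrArg (fun L : V →ₗ[ℚ] V => L v) hA
    simpa [β, δ, LinearMap.sum_apply] using this
  have hker : LinearMap.ker β = ⨅ c, LinearMap.ker (A c) := by
    ext v
    simp [β, funext_iff, Subtype.ext_iff]
  have hrange : (⨆ c, LinearMap.range (A c)) ≤ LinearMap.range δ := by
    refine iSup_le fun c v hv => ⟨Pi.single c ⟨v, hv⟩, ?_⟩
    simp only [δ, LinearMap.sum_apply, LinearMap.comp_apply, LinearMap.proj_apply,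
      Submodule.subtype_apply]
    rw [Finset.sum_eq_single c]
    · simp
    · intro d _ hd
      simp [Pi.single_eq_of_ne hd]
    · simp
  have h1 := LinearMap.finrank_range_add_finrank_ker β
  have h2 := LinearMap.finrank_range_add_finrank_ker δ
  have h3 := Submodule.finrank_mono hδβ
  have h4 := Submodule.finrank_mono hrange
  rw [hker] at h1
  rw [finrank_pi_fintype] at h2
  omega

/-- Scott's inequality for permutation modules: nonnegativity of the genus. -/
theorem two_mul_card_add_sum_finrank_le {ι B : Type*} [Fintype ι] [Fintype B]
    (p : ι → Equiv.Perm B) (τ : Equiv.Perm ι) (c₀ : ι) (h₀ : p c₀ = 1)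
    (hτ : ∀ c, τ.SameCycle c₀ c) (N : ι → Submodule ℚ (B → ℚ))
    (hN : ∀ c, ∀ f ∈ N c, ∀ x y, p c x = p (τ c) y → f x = f y)
    (K : Submodule ℚ (B → ℚ))
    (hK : ∀ f : B → ℚ, (∀ c x y, p c x = p (τ c) y → f x = f y) → f ∈ K) :
    2 * Fintype.card B + ∑ c, finrank ℚ (N c)
      ≤ Fintype.card ι * Fintype.card B + 2 * finrank ℚ K := by
  classical
  let A : ι → (B → ℚ) →ₗ[ℚ] (B → ℚ) := fun c =>
    LinearMap.funLeft ℚ ℚ (p c) - LinearMap.funLeft ℚ ℚ (p (τ c))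
  have hA : ∑ c, A c = 0 := by
    simp only [A, Finset.sum_sub_distrib]
    rw [Equiv.sum_comp τ (fun c => LinearMap.funLeft ℚ ℚ (p c)), sub_self]
  have main := finrank_add_finrank_iSup_range_le A hA
  have hker : (⨅ c, LinearMap.ker (A c)) ≤ K := by
    intro u hu
    have hu' : ∀ c, u ∘ p c = u ∘ p (τ c) := by
      intro c
      have := (Submodule.mem_iInf _).1 hu c
      exact sub_eq_zero.1 (LinearMap.mem_ker.1 this)
    have hz : ∀ c, u ∘ p c = u := by
      intro c
      obtain ⟨n, rfl⟩ := (hτ c).exists_nat_pow_eq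
      induction n with
      | zero => simp [h₀]
      | succ n ih => rw [pow_succ', Equiv.Perm.mul_apply, ← hu', ih]
    refine hK u fun c x y h => ?_
    rw [← congrFun (hz c) x, ← congrFun (hz (τ c)) y]
    exact congrArg u h
  have hrank : ∀ c, finrank ℚ (LinearMap.range (A c)) + finrank ℚ (N c) ≤ Fintype.card B := by
    intro c
    have h1 := LinearMap.finrank_range_add_finrank_ker (A c)
    rw [finrank_fintype_fun_eq_card] at h1
    have h2 : (N c).map (LinearEquiv.funCongrLeft ℚ ℚ (p c).symm : (B → ℚ) →ₗ[ℚ] (B → ℚ))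
        ≤ LinearMap.ker (A c) := by
      rintro _ ⟨f, hf, rfl⟩
      refine LinearMap.mem_ker.2 (funext fun x => sub_eq_zero.2 ?_)
      have := hN c f hf ((p c).symm (p (τ c) x)) x (by simp)
      simpa [LinearMap.funLeft_apply, LinearEquiv.funCongrLeft_apply] using this.symm
    have h3 := Submodule.finrank_mono h2
    rw [LinearEquiv.finrank_map_eq] at h3
    omega
  have hsup : Fintype.card B
      ≤ finrank ℚ (⨆ c, LinearMap.range (A c) : Submodule ℚ (B → ℚ)) + finrank ℚ K := by
    set R : Submodule ℚ (B → ℚ) := ⨆ c, LinearMap.range (A c)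
    have h1 := Subspace.finrank_add_finrank_dualAnnihilator_eq R
    rw [finrank_fintype_fun_eq_card] at h1
    let e : Dual ℚ (B → ℚ) →ₗ[ℚ] (B → ℚ) :=
      { toFun := fun φ x => φ (Pi.single x 1)
        map_add' := fun _ _ => rfl
        map_smul' := fun _ _ => rfl }
    have he : Function.Injective e := by
      intro φ ψ h
      refine LinearMap.pi_ext' fun x => LinearMap.ext_ring ?_
      exact congrFun h x
    have h2 : R.dualAnnihilator.map e ≤ K := by
      rintro _ ⟨φ, hφ, rfl⟩
      refine hK _ fun c x y h => ?_
      have hm : A c (Pi.single (p c x) 1) ∈ R :=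
        Submodule.mem_iSup_of_mem c ⟨_, rfl⟩
      have hx : ∀ (q : Equiv.Perm B) (z : B),
          LinearMap.funLeft ℚ ℚ q (Pi.single (q z) 1) = Pi.single z 1 := by
        intro q z
        ext w
        simp [LinearMap.funLeft_apply, Pi.single_apply]
      have h3 : A c (Pi.single (p c x) 1) = Pi.single x 1 - Pi.single y 1 := by
        simp only [A, LinearMap.sub_apply]
        rw [hx, h, hx]
      have h4 := (Submodule.mem_dualAnnihilator φ).1 hφ _ hm
      rw [h3, map_sub, sub_eq_zero] at h4
      exact h4
    have h3 := Submodule.finrank_mono h2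
    rw [← (Submodule.equivMapOfInjective e he R.dualAnnihilator).finrank_eq] at h3
    omega
  have hsum := Finset.sum_le_sum fun c (_ : c ∈ Finset.univ) => hrank c
  rw [Finset.sum_add_distrib, Finset.sum_const, Finset.card_univ, smul_eq_mul] at hsum
  have h5 := Submodule.finrank_mono hker
  rw [finrank_fintype_fun_eq_card] at main
  omega

/-- The functions on `s` constant along all the faces `{c, τ c}`. -/
abbrev jacketInvariants {ι B W : Type*} (σ : ι → B ≃ W) (τ : Equiv.Perm ι) (s : Set B) :
    Submodule ℚ (s → ℚ) :=
  relInvariants (fun x y => ∃ c, σ c x = σ (τ c) y) s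

theorem two_mul_card_add_sum_numCyclesIn_le {ι B W : Type*} [Fintype ι] [Finite B]
    (σ : ι → B ≃ W) (τ : Equiv.Perm ι) (c₀ : ι) (hτ : ∀ c, τ.SameCycle c₀ c) (s : Set B)
    (hs : ∀ c c', ∀ x ∈ s, (σ c').symm (σ c x) ∈ s) :
    2 * Nat.card s + ∑ c, numCyclesIn ((σ c).trans (σ (τ c)).symm) s
      ≤ Fintype.card ι * Nat.card s + 2 * finrank ℚ (jacketInvariants σ τ s) := by
  have := Fintype.ofFinite s
  let p : ι → Equiv.Perm s := fun c => Equiv.Perm.subtypePerm ((σ c).trans (σ c₀).symm) fun x =>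
    ⟨fun h => by simpa using hs c₀ c _ h, fun h => hs c c₀ x h⟩
  have hp : ∀ c c' (x y : s), p c x = p c' y ↔ σ c x = σ c' y := by
    intro c c' x y
    simp [p, Subtype.ext_iff]
  have := two_mul_card_add_sum_finrank_le p τ c₀ (by ext x; simp [p]) hτ
    (fun c => relInvariants (fun x y => (σ c).trans (σ (τ c)).symm x = y) s)
    (fun c f hf x y h => hf x y ((Equiv.symm_apply_eq _).2 ((hp _ _ _ _).1 h)))
    (jacketInvariants σ τ s)
    (fun f hf x y ⟨c, h⟩ => hf c x y ((hp _ _ _ _).2 h))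
  rw [Nat.card_eq_fintype_card]
  convert this using 3 with c
  exact numCyclesIn_eq_finrank _ _ (hs c (τ c))

theorem eq_of_mem_jacketInvariants {ι B W : Type*} [Finite ι] {σ : ι → B ≃ W}
    {τ : Equiv.Perm ι} {s : Set B} (hs : ∀ c c', ∀ x ∈ s, (σ c').symm (σ c x) ∈ s)
    {f : s → ℚ} (hf : f ∈ jacketInvariants σ τ s) {c c' : ι} (h : τ.SameCycle c c')
    {x y : s} (hxy : σ c x = σ c' y) : f x = f y := by
  obtain ⟨n, rfl⟩ := h.exists_nat_pow_eq
  induction n generalizing y with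
  | zero => exact congrArg f (Subtype.ext ((σ c).injective hxy))
  | succ n ih =>
    let z : s := ⟨(σ ((τ ^ n) c)).symm (σ c x), hs _ _ _ x.2⟩
    have hz : σ ((τ ^ n) c) z = σ c x := by simp [z]
    refine (ih ⟨n, by simp⟩ hz.symm).trans (hf z y ⟨(τ ^ n) c, ?_⟩)
    rw [hz, hxy, pow_succ', Equiv.Perm.mul_apply]

theorem eq_of_mem_closure {B : Type*} {S : Set (Equiv.Perm B)} {s : Set B}
    (hs : ∀ g ∈ Subgroup.closure S, ∀ x ∈ s, g x ∈ s) {f : s → ℚ}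
    (hf : ∀ g ∈ S, ∀ x y : s, g x = y → f x = f y) {g : Equiv.Perm B}
    (hg : g ∈ Subgroup.closure S) (x y : s) (h : g x = y) : f x = f y := by
  induction hg using Subgroup.closure_induction generalizing x y with
  | mem g hg => exact hf g hg x y h
  | one => exact congrArg f (Subtype.ext h)
  | mul a b ha hb iha ihb =>
    exact (ihb x ⟨b x, hs b hb x x.2⟩ rfl).trans (iha _ y h)
  | inv a ha iha => exact (iha y x (by simp [← h])).symm

theorem finrank_le_one_of_forall_eq {X : Type*} [Finite X] (K : Submodule ℚ (X → ℚ))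
    (h : ∀ f ∈ K, ∀ x y, f x = f y) : finrank ℚ K ≤ 1 := by
  have : K ≤ Submodule.span ℚ {fun _ => (1 : ℚ)} := by
    intro f hf
    rw [Submodule.mem_span_singleton]
    rcases isEmpty_or_nonempty X with hX | ⟨⟨x⟩⟩
    · exact ⟨0, Subsingleton.elim _ _⟩
    · exact ⟨f x, funext fun y => by simp [h f hf x y]⟩
  exact (Submodule.finrank_mono this).trans
    ((finrank_span_le_card _).trans (by simp))

theorem one_le_finrank_relInvariants {B : Type*} [Finite B] (r : B → B → Prop) (s : Set B)
    (hs : s.Nonempty) : 1 ≤ finrank ℚ (relInvariants r s) := by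
  obtain ⟨b, hb⟩ := hs
  have : Nontrivial (relInvariants r s) :=
    ⟨⟨⟨fun _ => 1, fun _ _ _ => rfl⟩, 0, fun h => by
      simpa using congrFun (congrArg Subtype.val h) ⟨b, hb⟩⟩⟩
  exact finrank_pos

theorem finrank_relInvariants_add_compl_le {B : Type*} [Finite B] (r : B → B → Prop) (s : Set B)
    (hr : ∀ x y, r x y → (x ∈ s ↔ y ∈ s)) :
    finrank ℚ (relInvariants r s) + finrank ℚ (relInvariants r sᶜ)
      ≤ finrank ℚ (relInvariants r Set.univ) := by
  classical
  let L : (s → ℚ) × (↑(sᶜ : Set B) → ℚ) →ₗ[ℚ] (↑(Set.univ : Set B) → ℚ) :=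
    { toFun := fun fg x => if h : (x : B) ∈ s then fg.1 ⟨x, h⟩ else fg.2 ⟨x, h⟩
      map_add' := fun a b => by ext x; by_cases h : (x : B) ∈ s <;> simp [h]
      map_smul' := fun a b => by ext x; by_cases h : (x : B) ∈ s <;> simp [h] }
  have hL : Function.Injective L := by
    rintro ⟨f, g⟩ ⟨f', g'⟩ h
    refine Prod.ext (funext fun x => ?_) (funext fun x => ?_)
    · have := congrFun h ⟨x, trivial⟩
      simpa [L, x.2] using this
    · have := congrFun h ⟨x, trivial⟩
      have hx : (x : B) ∉ s := x.2
      simpa [L, hx] using this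
  let L' := L ∘ₗ (relInvariants r s).subtype.prodMap (relInvariants r sᶜ).subtype
  have hL' : Function.Injective L' :=
    hL.comp (Function.Injective.prodMap Subtype.val_injective Subtype.val_injective)
  have h1 : LinearMap.range L' ≤ relInvariants r Set.univ := by
    rintro _ ⟨⟨⟨f, hf⟩, ⟨g, hg⟩⟩, rfl⟩ x y hxy
    by_cases hx : (x : B) ∈ s
    · have hy := (hr _ _ hxy).1 hx
      simpa [L', L, hx, hy] using hf ⟨x, hx⟩ ⟨y, hy⟩ hxy
    · have hy : (y : B) ∉ s := fun hy => hx ((hr _ _ hxy).2 hy)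
      simpa [L', L, hx, hy] using hg ⟨x, hx⟩ ⟨y, hy⟩ hxy
  have h2 := Submodule.finrank_mono h1
  rw [LinearMap.finrank_range_of_inj hL', finrank_prod] at h2
  exact h2

theorem numCycles_eq_add_compl {B : Type*} [Finite B] (π : Equiv.Perm B) (s : Set B)
    (hs : ∀ x, x ∈ s ↔ π x ∈ s) : numCycles π = numCyclesIn π s + numCyclesIn π sᶜ := by
  have hu : cyclesIn π Set.univ = cyclesIn π s ∪ cyclesIn π sᶜ := by
    ext t
    constructor
    · rintro ⟨b, -, rfl⟩
      by_cases hb : b ∈ s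
      · exact Or.inl ⟨b, hb, rfl⟩
      · exact Or.inr ⟨b, hb, rfl⟩
    · rintro (⟨b, -, rfl⟩ | ⟨b, -, rfl⟩) <;> exact ⟨b, trivial, rfl⟩
  have hd : Disjoint (cyclesIn π s) (cyclesIn π sᶜ) := by
    rw [Set.disjoint_left]
    rintro _ ⟨b, hb, rfl⟩ ⟨b', hb', h⟩
    have h1 : b' ∈ cycleSet π b := h ▸ Equiv.Perm.SameCycle.refl π b'
    obtain ⟨n, rfl⟩ := Equiv.Perm.SameCycle.exists_nat_pow_eq h1
    refine hb' ?_
    clear hb' h h1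
    induction n with
    | zero => exact hb
    | succ n ih => rw [pow_succ', Equiv.Perm.mul_apply]; exact (hs _).1 ih
  simp only [numCycles, numCyclesIn, hu, Nat.card_coe_set_eq]
  exact Set.ncard_union_eq hd

theorem sameCycle_of_inducedEq {D : ℕ} {i : Fin (D + 1)} {τ : Equiv.Perm (Fin (D + 1))}
    (hτ : IsFullCycle τ) {ω : Equiv.Perm {x : Fin (D + 1) // x ≠ i}} (hω : InducedEq i τ ω)
    (c c' : {x : Fin (D + 1) // x ≠ i}) : ω.SameCycle c c' := by
  have hne : ∀ d, τ d ≠ d := fun d => Equiv.Perm.mem_support.1 (hτ.2 ▸ Finset.mem_univ d)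
  let Q : Fin (D + 1) → Prop := fun d =>
    if h : d = i then ω.SameCycle c ⟨τ i, hne i⟩ else ω.SameCycle c ⟨d, h⟩
  have hQ : ∀ d, Q d → Q (τ d) := by
    intro d hd
    by_cases h : d = i
    · subst h
      simpa [Q, hne d] using hd
    · have hd' : ω.SameCycle c ⟨d, h⟩ := by simpa [Q, h] using hd
      have h1 : ω.SameCycle c (ω ⟨d, h⟩) := hd'.trans ⟨1, by simp⟩
      have h2 := hω ⟨d, h⟩
      by_cases h3 : τ d = i
      · have : ω ⟨d, h⟩ = ⟨τ i, hne i⟩ := Subtype.ext (by simpa [h3] using h2)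
        simpa [Q, h3, this] using h1
      · have : ω ⟨d, h⟩ = ⟨τ d, h3⟩ := Subtype.ext (by simpa [h3] using h2)
        simpa [Q, h3, this] using h1
  obtain ⟨n, hn⟩ := (hτ.1.sameCycle (hne c) (hne c')).exists_nat_pow_eq
  have : ∀ n : ℕ, Q ((τ ^ n) c) := by
    intro n
    induction n with
    | zero => simp [Q, c.2, Equiv.Perm.SameCycle.refl]
    | succ n ih => rw [pow_succ', Equiv.Perm.mul_apply]; exact hQ _ ih
  have := this n
  rw [hn] at this
  simpa [Q, c'.2] using this

theorem jacketFaces_add_numCycles {D : ℕ} {B W : Type*} (σ : Fin (D + 1) → B ≃ W)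
    {i : Fin (D + 1)} {τ : Equiv.Perm (Fin (D + 1))} (hi : τ.symm i ≠ i)
    {ω : Equiv.Perm {x : Fin (D + 1) // x ≠ i}} (hω : InducedEq i τ ω) :
    jacketFaces σ τ + numCycles (facePerm σ (τ.symm i) (τ i))
      = bubbleJacketFaces σ i Set.univ ω + numCycles (facePerm σ (τ.symm i) i)
        + numCycles (facePerm σ i (τ i)) := by
  have h1 : jacketFaces σ τ = numCycles (facePerm σ i (τ i))
      + ∑ c : {x : Fin (D + 1) // x ≠ i}, numCycles (facePerm σ c (τ c)) :=
    Fintype.sum_eq_add_sum_subtype_ne _ i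
  let a : {x : Fin (D + 1) // x ≠ i} := ⟨τ.symm i, hi⟩
  have ha : τ a = i := τ.apply_symm_apply i
  have hωa : (ω a : Fin (D + 1)) = τ i := by rw [hω a, if_pos ha, ha]
  have h2 : ∑ c ∈ Finset.univ.erase a, numCycles (facePerm σ c (τ c))
      = ∑ c ∈ Finset.univ.erase a, numCyclesIn (facePerm σ c (ω c)) Set.univ := by
    refine Finset.sum_congr rfl fun c hc => ?_
    have : τ c ≠ i := fun h =>
      Finset.ne_of_mem_erase hc (Subtype.ext (τ.injective (h.trans ha.symm)))
    rw [hω c, if_neg this, numCycles]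
  rw [h1, bubbleJacketFaces, ← Finset.add_sum_erase _ _ (Finset.mem_univ a),
    ← Finset.add_sum_erase (a := a) _ (fun c : {x : Fin (D + 1) // x ≠ i} =>
      numCyclesIn (facePerm σ c (ω c)) Set.univ) (Finset.mem_univ a), h2, ha, hωa]
  simp only [numCycles, a]
  ring

theorem bubbleJacketFaces_univ_eq {D : ℕ} {B W : Type*} [Finite B] (σ : Fin (D + 1) → B ≃ W)
    (i : Fin (D + 1)) (s : Set B) (ω : Equiv.Perm {x : Fin (D + 1) // x ≠ i})
    (hs : ∀ c c', c ≠ i → c' ≠ i → ∀ x, x ∈ s ↔ facePerm σ c c' x ∈ s) :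
    bubbleJacketFaces σ i Set.univ ω
      = bubbleJacketFaces σ i s ω + bubbleJacketFaces σ i sᶜ ω := by
  simp only [bubbleJacketFaces, ← Finset.sum_add_distrib]
  exact Finset.sum_congr rfl fun c _ =>
    numCycles_eq_add_compl _ s (hs c (ω c) c.2 (ω c).2)

theorem mem_iff_of_mem_bubbles {D : ℕ} {B W : Type*} {σ : Fin (D + 1) → B ≃ W}
    {i : Fin (D + 1)} {ρ : Set B} (hρ : ρ ∈ bubbles σ i) {g : Equiv.Perm B}
    (hg : g ∈ bubbleGroup σ i) (x : B) : x ∈ ρ ↔ g x ∈ ρ := by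
  obtain ⟨b, rfl⟩ := hρ
  constructor
  · rintro ⟨k, hk, rfl⟩
    exact ⟨g * k, mul_mem hg hk, rfl⟩
  · rintro ⟨k, hk, h⟩
    exact ⟨g⁻¹ * k, mul_mem (inv_mem hg) hk, by simp [h]⟩

theorem finrank_jacketInvariants_bubble {D : ℕ} {B W : Type*} [Finite B]
    {σ : Fin (D + 1) → B ≃ W} {i : Fin (D + 1)} {ρ : Set B} (hρ : ρ ∈ bubbles σ i)
    {ω : Equiv.Perm {x : Fin (D + 1) // x ≠ i}} (hω : ∀ c c', ω.SameCycle c c') :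
    finrank ℚ (jacketInvariants (fun c : {x : Fin (D + 1) // x ≠ i} => σ c) ω ρ) = 1 := by
  refine le_antisymm (finrank_le_one_of_forall_eq _ fun f hf => ?_)
    (one_le_finrank_relInvariants _ _ ?_)
  · have key : ∀ g ∈ bubbleGroup σ i, ∀ x y : ρ, g x = y → f x = f y := by
      intro g hg
      refine eq_of_mem_closure (fun g hg x => (mem_iff_of_mem_bubbles hρ hg x).1) ?_ hg
      rintro _ ⟨j, k, hj, hk, rfl⟩ x y h
      refine eq_of_mem_jacketInvariants (σ := fun c : {x : Fin (D + 1) // x ≠ i} => σ c)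
        (fun c c' x => (mem_iff_of_mem_bubbles hρ
          (Subgroup.subset_closure ⟨c, c', c.2, c'.2, rfl⟩) x).1)
        hf (hω ⟨j, hj⟩ ⟨k, hk⟩) ((Equiv.symm_apply_eq _).1 h)
    obtain ⟨b, rfl⟩ := hρ
    rintro ⟨x, g, hg, rfl⟩ ⟨y, k, hk, rfl⟩
    exact key (k * g⁻¹) (mul_mem hk (inv_mem hg)) _ _ (by simp)
  · obtain ⟨b, rfl⟩ := hρ
    exact ⟨b, 1, one_mem _, rfl⟩

/-- Submodularity of the number of components: the graphs with colors `{a, i, b}` and `î`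
share the faces `{a, b}`, and their union is connected. -/
theorem finrank_add_finrank_le_numCycles_add_one {D : ℕ} {B W : Type*} [Finite B]
    {σ : Fin (D + 1) → B ≃ W} (hconn : IsConnectedGraph σ) {i : Fin (D + 1)}
    {ω : Equiv.Perm {x : Fin (D + 1) // x ≠ i}} (hω : ∀ c c', ω.SameCycle c c')
    {a b : Fin (D + 1)} (ha : a ≠ i) (hb : b ≠ i) :
    finrank ℚ (jacketInvariants (fun c => σ (![a, i, b] c)) (finRotate 3) Set.univ)
      + finrank ℚ (jacketInvariants (fun c : {x : Fin (D + 1) // x ≠ i} => σ c) ω Set.univ)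
      ≤ numCycles (facePerm σ b a) + 1 := by
  set K₃ := jacketInvariants (fun c => σ (![a, i, b] c)) (finRotate 3) Set.univ
  set K := jacketInvariants (fun c : {x : Fin (D + 1) // x ≠ i} => σ c) ω Set.univ
  have hKeq : ∀ f ∈ K, ∀ j k, j ≠ i → k ≠ i → ∀ x y : (Set.univ : Set B),
      σ j x = σ k y → f x = f y := fun f hf j k hj hk x y h =>
    eq_of_mem_jacketInvariants (fun _ _ _ _ => Set.mem_univ _) hf (hω ⟨j, hj⟩ ⟨k, hk⟩) h
  have hsup : K₃ ⊔ K ≤ relInvariants (fun x y => facePerm σ b a x = y) Set.univ := by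
    refine sup_le (fun f hf x y h => hf x y ⟨2, ?_⟩) fun f hf x y h =>
      hKeq f hf b a hb ha x y ((Equiv.symm_apply_eq _).1 h)
    have h' : σ b x = σ a y := (Equiv.symm_apply_eq _).1 h
    simpa using h'
  have hinf : finrank ℚ (K₃ ⊓ K : Submodule ℚ _) ≤ 1 := by
    refine finrank_le_one_of_forall_eq _ fun f ⟨hf₃, hf⟩ x y => ?_
    have hai : ∀ x y : (Set.univ : Set B), σ a x = σ i y → f x = f y := fun x y h =>
      hf₃ x y ⟨0, by simpa using h⟩
    obtain ⟨g, hg, hgx⟩ := hconn x y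
    refine eq_of_mem_closure (fun _ _ _ _ => Set.mem_univ _) ?_ hg x y hgx
    rintro _ ⟨j, k, rfl⟩ x y h
    have hjk : σ j x = σ k y := (Equiv.symm_apply_eq _).1 h
    let z : (Set.univ : Set B) := ⟨(σ a).symm (σ j x), trivial⟩
    have hz : σ a z = σ j x := by simp [z]
    have hxz : f x = f z := by
      by_cases hj : j = i
      · subst hj
        exact (hai z x hz).symm
      · exact hKeq f hf j a hj ha x z hz.symm
    refine hxz.trans ?_
    by_cases hk : k = i
    · subst hk
      exact hai z y (hz.trans hjk)
    · exact hKeq f hf a k ha hk z y (hz.trans hjk)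
  have h1 := Submodule.finrank_sup_add_finrank_inf_eq K₃ K
  have h2 := Submodule.finrank_mono hsup
  rw [← numCyclesIn_eq_finrank _ _ (fun _ _ => Set.mem_univ _)] at h2
  rw [numCycles]
  omega

theorem numCycles_facePerm_comm {D : ℕ} {B W : Type*} (σ : Fin (D + 1) → B ≃ W)
    (i j : Fin (D + 1)) : numCycles (facePerm σ i j) = numCycles (facePerm σ j i) := by
  have h : facePerm σ i j = (facePerm σ j i)⁻¹ := rfl
  simp only [numCycles, numCyclesIn, cyclesIn, cycleSet, h, Equiv.Perm.sameCycle_inv]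

/-- If a jacket `J = {τ, τ⁻¹}` of a connected bipartite `(D+1)`-colored graph is planar
(`χ_J = 2`, i.e. `g_J = 0`), then for every color `i` and every `D`-bubble `ρ` of
colors `î`, the jacket of the bubble induced by `τ` is planar:
`2·p_ρ - D·p_ρ + F_{J'} = 2`. -/
theorem planar_jacket_induces_planar_bubble_jackets (D : ℕ) (hD : 3 ≤ D) (B W : Type)
    [Fintype B] [DecidableEq B] [Nonempty B] (σ : Fin (D + 1) → B ≃ W)
    (hconn : IsConnectedGraph σ)
    (τ : Equiv.Perm (Fin (D + 1))) (hτ : IsFullCycle τ)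
    (hplanar : 2 * (Fintype.card B : ℤ) - (D + 1) * (Fintype.card B : ℤ) +
      (jacketFaces σ τ : ℤ) = 2)
    (i : Fin (D + 1)) (ρ : Set B) (hρ : ρ ∈ bubbles σ i)
    (ω : Equiv.Perm {x : Fin (D + 1) // x ≠ i}) (hω : InducedEq i τ ω) :
    2 * (Nat.card ρ : ℤ) - (D : ℤ) * (Nat.card ρ : ℤ) +
      (bubbleJacketFaces σ i ρ ω : ℤ) = 2 := by
  have hne : ∀ d, τ d ≠ d := fun d => Equiv.Perm.mem_support.1 (hτ.2 ▸ Finset.mem_univ d)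
  have ha : τ.symm i ≠ i := fun h => hne i ((Equiv.symm_apply_eq τ).1 h).symm
  have hcyc := sameCycle_of_inducedEq hτ hω
  have hρs : ∀ c c', c ≠ i → c' ≠ i → ∀ x, x ∈ ρ ↔ facePerm σ c c' x ∈ ρ :=
    fun c c' hc hc' x =>
      mem_iff_of_mem_bubbles hρ (Subgroup.subset_closure ⟨c, c', hc, hc', rfl⟩) x
  have hfaces := jacketFaces_add_numCycles σ ha hω
  rw [bubbleJacketFaces_univ_eq σ i ρ ω hρs] at hfaces
  have hbubble := two_mul_card_add_sum_numCyclesIn_le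
    (fun c : {x : Fin (D + 1) // x ≠ i} => σ c) ω ⟨τ i, hne i⟩ (hcyc _) ρ
    (fun c c' x => (hρs c c' c.2 c'.2 x).1)
  have hcompl := two_mul_card_add_sum_numCyclesIn_le
    (fun c : {x : Fin (D + 1) // x ≠ i} => σ c) ω ⟨τ i, hne i⟩ (hcyc _) ρᶜ
    (fun c c' x => (not_congr (hρs c c' c.2 c'.2 x)).1)
  have hthree := two_mul_card_add_sum_numCyclesIn_le
    (fun c => σ (![τ.symm i, i, τ i] c)) (finRotate 3) 0 (by decide) Set.univ
    (fun _ _ _ _ => trivial)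
  have hsub := finrank_add_finrank_le_numCycles_add_one hconn hcyc ha (hne i)
  have hsplit := finrank_relInvariants_add_compl_le
    (fun x y => ∃ c : {x : Fin (D + 1) // x ≠ i}, σ c x = σ (ω c) y) ρ (by
      rintro x y ⟨c, h⟩
      have hy : facePerm σ c (ω c) x = y := (Equiv.symm_apply_eq _).2 h
      exact hy ▸ hρs c (ω c) c.2 (ω c).2 x)
  have hone := finrank_jacketInvariants_bubble hρ hcyc
  have hcard : Nat.card ρ + Nat.card (ρᶜ : Set B) = Fintype.card B := by
    rw [← Nat.card_eq_fintype_card]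
    exact Set.ncard_add_ncard_compl ρ
  have hι : Fintype.card {x : Fin (D + 1) // x ≠ i} = D := by simp
  have hsum : ∑ c : Fin 3, numCyclesIn ((σ (![τ.symm i, i, τ i] c)).trans
      (σ (![τ.symm i, i, τ i] (finRotate 3 c))).symm) Set.univ
      = numCycles (facePerm σ (τ.symm i) i) + numCycles (facePerm σ i (τ i))
        + numCycles (facePerm σ (τ i) (τ.symm i)) := by
    rw [Fin.sum_univ_three]
    rfl
  rw [hι] at hbubble hcompl
  rw [hsum, Fintype.card_fin, Nat.card_univ, Nat.card_eq_fintype_card] at hthree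
  rw [numCycles_facePerm_comm σ (τ.symm i) (τ i)] at hfaces
  change _ + bubbleJacketFaces σ i ρ ω ≤ _ at hbubble
  change _ + bubbleJacketFaces σ i ρᶜ ω ≤ _ at hcompl
  have hprod : (D : ℤ) * Fintype.card B = D * Nat.card ρ + D * Nat.card (ρᶜ : Set B) := by
    rw [← hcard]
    push_cast
    ring
  rw [hone] at hbubble hsplit
  zify at *
  linarith
end
end
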